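/- arXiv:1508.06346 — 8 statements merged into one kernel-verified Lean document; each statement's English description precedes it below -/
import Mathlib

section
/- Let G be a connected simple graph with N vertices and M edges, E an oriented incidence matrix of G, L = E Eᵀ, L_e = Eᵀ E, and L† the Moore–Penrose pseudoinverse of L. Let Γ ∈ ℝ^{(N−1)×(N−1)} be a diagonal matrix with strictly positive diagonal entries and let V₂ ∈ ℝ^{N×(N−1)} satisfy V₂ᵀ V₂ = I_{N−1} and L V₂ = V₂ Γ. Set U₂ = Eᵀ V₂ Γ^{−1/2}, where Γ^{−1/2} is the diagonal matrix whose diagonal entries are the inverse square roots of those of Γ. Then: (i) U₂ᵀ U₂ = I_{N−1}; (ii) U₂ᵀ L_e U₂ = Γ; (iii) for any U₁ ∈ ℝ^{M×(M−N+1)} with Eᵀ L† E U₁ = 0, one has U₂ᵀ U₁ = 0 and L_e U₁ = 0. -/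
open Matrix

/-- `E` is an oriented incidence matrix of the simple graph `G`: its columns are in
bijection with the edges of `G`, and the column corresponding to an edge `{i, j}` has
entry `1` in row `i`, entry `-1` in row `j`, and `0` elsewhere. -/
def IsOrientedIncidenceMatrix {N M : ℕ} (G : SimpleGraph (Fin N))
    (E : Matrix (Fin N) (Fin M) ℝ) : Prop :=
  ∃ φ : Fin M ≃ G.edgeSet,
    ∀ e : Fin M, ∃ i j : Fin N,
      (φ e : Sym2 (Fin N)) = s(i, j) ∧ E i e = 1 ∧ E j e = -1 ∧
      ∀ k : Fin N, k ≠ i → k ≠ j → E k e = 0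

/-- If `P` acts as the identity on `A * Aᵀ`, then it acts as the identity on `A`. -/
theorem mul_eq_self_of_mul_mul_transpose_eq {m n : Type*} [Fintype m] [Fintype n]
    {P : Matrix m m ℝ} {A : Matrix m n ℝ} (h : P * (A * Aᵀ) = A * Aᵀ) : P * A = A := by
  have hz : (P * A - A) * (P * A - A)ᴴ = 0 := by
    rw [conjTranspose_eq_transpose_of_trivial, transpose_sub, transpose_mul, Matrix.mul_sub,
      Matrix.sub_mul, Matrix.sub_mul, ← Matrix.mul_assoc, ← Matrix.mul_assoc,
      Matrix.mul_assoc P A Aᵀ, h]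
    simp
  exact sub_eq_zero.mp (self_mul_conjTranspose_eq_zero.mp hz)

/-- With `Γ` diagonal positive, `V₂` orthonormal columns of eigenvectors of `L` and
`U₂ = Eᵀ V₂ Γ^{-1/2}`: (i) `U₂ᵀ U₂ = I`; (ii) `U₂ᵀ L_e U₂ = Γ`; (iii) any `U₁` with
`Eᵀ L† E U₁ = 0` satisfies `U₂ᵀ U₁ = 0` and `L_e U₁ = 0`. -/
theorem edge_basis_properties {N M : ℕ} (hN : 2 ≤ N)
    (G : SimpleGraph (Fin N)) (hG : G.Connected)
    (E : Matrix (Fin N) (Fin M) ℝ) (hE : IsOrientedIncidenceMatrix G E)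
    (L : Matrix (Fin N) (Fin N) ℝ) (hL : L = E * Eᵀ)
    (Le : Matrix (Fin M) (Fin M) ℝ) (hLe : Le = Eᵀ * E)
    (Ld : Matrix (Fin N) (Fin N) ℝ)
    (h1 : L * Ld * L = L) (h2 : Ld * L * Ld = Ld)
    (h3 : (L * Ld)ᵀ = L * Ld) (h4 : (Ld * L)ᵀ = Ld * L)
    (g : Fin (N - 1) → ℝ) (hg : ∀ i, 0 < g i)
    (Γ : Matrix (Fin (N - 1)) (Fin (N - 1)) ℝ) (hΓ : Γ = Matrix.diagonal g)
    (V₂ : Matrix (Fin N) (Fin (N - 1)) ℝ) (hV₂ : V₂ᵀ * V₂ = 1)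
    (hLV₂ : L * V₂ = V₂ * Γ)
    (U₂ : Matrix (Fin M) (Fin (N - 1)) ℝ)
    (hU₂ : U₂ = Eᵀ * V₂ * Matrix.diagonal fun i => (Real.sqrt (g i))⁻¹) :
    U₂ᵀ * U₂ = 1 ∧
    U₂ᵀ * Le * U₂ = Γ ∧
    ∀ U₁ : Matrix (Fin M) (Fin (M - (N - 1))) ℝ,
      (Eᵀ * Ld * E) * U₁ = 0 → U₂ᵀ * U₁ = 0 ∧ Le * U₁ = 0 := by
  subst hL hLe hΓ hU₂
  have hs (i) : Real.sqrt (g i) ≠ 0 := (Real.sqrt_pos.mpr (hg i)).ne'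
  have hVL : V₂ᵀ * (E * Eᵀ) = diagonal g * V₂ᵀ := by
    simpa using congrArg transpose hLV₂
  have hD : (diagonal fun i => (Real.sqrt (g i))⁻¹) * diagonal g *
      (diagonal fun i => (Real.sqrt (g i))⁻¹) = 1 := by
    rw [diagonal_mul_diagonal, diagonal_mul_diagonal, ← diagonal_one]
    congr 1
    funext i
    have := hs i
    field_simp
    exact (Real.sq_sqrt (hg i).le).symm
  set D := diagonal fun i => (Real.sqrt (g i))⁻¹
  have hcomm : D * diagonal g = diagonal g * D := by
    simp only [D, diagonal_mul_diagonal, mul_comm]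
  have hUt : (Eᵀ * V₂ * D)ᵀ = D * V₂ᵀ * E := by
    simp [D, transpose_mul, Matrix.mul_assoc]
  rw [hUt]
  refine ⟨?_, ?_, fun U₁ hU₁ => ?_⟩
  · calc D * V₂ᵀ * E * (Eᵀ * V₂ * D) = D * (V₂ᵀ * (E * Eᵀ)) * V₂ * D := by
          simp only [Matrix.mul_assoc]
      _ = D * diagonal g * (V₂ᵀ * V₂) * D := by rw [hVL]; simp only [Matrix.mul_assoc]
      _ = 1 := by rw [hV₂, Matrix.mul_one, hD]
  · calc D * V₂ᵀ * E * (Eᵀ * E) * (Eᵀ * V₂ * D)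
        = D * (V₂ᵀ * (E * Eᵀ)) * (E * Eᵀ * V₂) * D := by simp only [Matrix.mul_assoc]
      _ = D * diagonal g * (V₂ᵀ * V₂) * diagonal g * D := by
          rw [hVL, hLV₂]; simp only [Matrix.mul_assoc]
      _ = diagonal g * (D * diagonal g * D) := by
          rw [hV₂, Matrix.mul_one, hcomm]; simp only [Matrix.mul_assoc, hcomm]
      _ = diagonal g := by rw [hD, Matrix.mul_one]
  · have hEU : E * U₁ = 0 := by
      calc E * U₁ = E * Eᵀ * Ld * E * U₁ := by
            rw [mul_eq_self_of_mul_mul_transpose_eq h1]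
        _ = E * (Eᵀ * Ld * E * U₁) := by simp only [Matrix.mul_assoc]
        _ = 0 := by rw [hU₁, Matrix.mul_zero]
    constructor <;> rw [Matrix.mul_assoc, hEU, Matrix.mul_zero]
end

section
/- Let A ∈ ℝ^{n×n}, B ∈ ℝ^{n×m}, let R₁ ∈ ℝ^{m×m} be symmetric positive definite and Q₁ ∈ ℝ^{n×n} symmetric, and let P₁ ∈ ℝ^{n×n} be a symmetric solution of the algebraic Riccati equation P₁ A + Aᵀ P₁ + Q₁ − P₁ B R₁ Bᵀ P₁ = 0. Let Γ ∈ ℝ^{(N−1)×(N−1)} be a diagonal matrix with strictly positive diagonal entries, μ > 0, Q₂ = P₁ B R₁ Bᵀ P₁, Q̃ = I_{N−1} ⊗ Q₁ + (μΓ − I_{N−1}) ⊗ Q₂, and R̃⁻¹ = μΓ ⊗ R₁. Then P̃ = I_{N−1} ⊗ P₁ satisfies the global Riccati equation P̃ (I_{N−1} ⊗ A) + (I_{N−1} ⊗ A)ᵀ P̃ + Q̃ − P̃ (I_{N−1} ⊗ B) R̃⁻¹ (I_{N−1} ⊗ B)ᵀ P̃ = 0, and the corresponding feedback gain satisfies F₂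 = R̃⁻¹ (I_{N−1} ⊗ B)ᵀ P̃ = μΓ ⊗ (R₁ Bᵀ P₁). -/
open Matrix Kronecker

/-- With the structured weighting matrices `Q̃ = I ⊗ Q₁ + (μΓ - I) ⊗ Q₂`,
`R̃⁻¹ = μΓ ⊗ R₁`, `Q₂ = P₁ B R₁ Bᵀ P₁`, and `P₁` a symmetric solution of the local
algebraic Riccati equation, the matrix `P̃ = I ⊗ P₁` solves the global Riccati
equation, and the feedback gain is `F₂ = μΓ ⊗ (R₁ Bᵀ P₁)`. -/
theorem global_riccati_kronecker_solution {N n m : ℕ}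
    (hN : 2 ≤ N) (hn : 1 ≤ n) (hm : 1 ≤ m)
    (A : Matrix (Fin n) (Fin n) ℝ) (B : Matrix (Fin n) (Fin m) ℝ)
    (R₁ : Matrix (Fin m) (Fin m) ℝ) (hR₁ : R₁.PosDef)
    (Q₁ : Matrix (Fin n) (Fin n) ℝ) (hQ₁ : Q₁ᵀ = Q₁)
    (P₁ : Matrix (Fin n) (Fin n) ℝ) (hP₁ : P₁ᵀ = P₁)
    (hARE : P₁ * A + Aᵀ * P₁ + Q₁ - P₁ * B * R₁ * Bᵀ * P₁ = 0)
    (g : Fin (N - 1) → ℝ) (hg : ∀ i, 0 < g i)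
    (Γ : Matrix (Fin (N - 1)) (Fin (N - 1)) ℝ) (hΓ : Γ = Matrix.diagonal g)
    (μ : ℝ) (hμ : 0 < μ)
    (Q₂ : Matrix (Fin n) (Fin n) ℝ) (hQ₂ : Q₂ = P₁ * B * R₁ * Bᵀ * P₁)
    (Qt : Matrix (Fin (N - 1) × Fin n) (Fin (N - 1) × Fin n) ℝ)
    (hQt : Qt = (1 : Matrix (Fin (N - 1)) (Fin (N - 1)) ℝ) ⊗ₖ Q₁
        + (μ • Γ - 1) ⊗ₖ Q₂)
    (Rinv : Matrix (Fin (N - 1) × Fin m) (Fin (N - 1) × Fin m) ℝ)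
    (hRinv : Rinv = (μ • Γ) ⊗ₖ R₁)
    (Pt : Matrix (Fin (N - 1) × Fin n) (Fin (N - 1) × Fin n) ℝ)
    (hPt : Pt = (1 : Matrix (Fin (N - 1)) (Fin (N - 1)) ℝ) ⊗ₖ P₁) :
    Pt * ((1 : Matrix (Fin (N - 1)) (Fin (N - 1)) ℝ) ⊗ₖ A)
      + ((1 : Matrix (Fin (N - 1)) (Fin (N - 1)) ℝ) ⊗ₖ A)ᵀ * Pt
      + Qt
      - Pt * ((1 : Matrix (Fin (N - 1)) (Fin (N - 1)) ℝ) ⊗ₖ B) * Rinv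
          * ((1 : Matrix (Fin (N - 1)) (Fin (N - 1)) ℝ) ⊗ₖ B)ᵀ * Pt = 0 ∧
    Rinv * ((1 : Matrix (Fin (N - 1)) (Fin (N - 1)) ℝ) ⊗ₖ B)ᵀ * Pt
      = (μ • Γ) ⊗ₖ (R₁ * Bᵀ * P₁) := by
  have hLocal : P₁ * A + Aᵀ * P₁ + Q₁ = Q₂ := hQ₂ ▸ sub_eq_zero.mp hARE
  subst hPt hRinv hQt
  simp only [← kroneckerMap_transpose, transpose_one, ← mul_kronecker_mul, one_mul, mul_one,
    and_true]
  rw [← hQ₂, ← kronecker_add, ← add_assoc, ← kronecker_add, hLocal, ← add_kronecker,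
    add_sub_cancel, sub_self]
end

section
/- Let A ∈ ℝ^{n×n}, B ∈ ℝ^{n×m}, let Q₁ ∈ ℝ^{n×n} be symmetric positive definite, R₁ ∈ ℝ^{m×m} symmetric positive definite, and let P₁ ∈ ℝ^{n×n} be a symmetric positive definite solution of the algebraic Riccati equation P₁ A + Aᵀ P₁ + Q₁ − P₁ B R₁ Bᵀ P₁ = 0. Then for every real c ≥ 1/2, every eigenvalue of A − c B R₁ Bᵀ P₁ (over ℂ) has strictly negative real part. -/
open Matrix

open scoped ComplexOrder in
/-- A real positive definite matrix is positive definite as a complex matrix. -/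
theorem Matrix.PosDef.map_ofReal {ι : Type*} [Fintype ι] {M : Matrix ι ι ℝ} (hM : M.PosDef) :
    (M.map Complex.ofReal).PosDef := by
  have hsymm : ∀ i j, M i j = M j i := fun i j => by simpa using (hM.1.apply i j).symm
  have hherm : (M.map Complex.ofReal).IsHermitian := by
    ext i j
    simp [hsymm j i]
  refine .of_dotProduct_mulVec_pos hherm fun x hx => ?_
  set a : ι → ℝ := fun i => (x i).re with ha
  set b : ι → ℝ := fun i => (x i).im with hb
  have hre : (star x ⬝ᵥ (M.map Complex.ofReal *ᵥ x)).re = a ⬝ᵥ (M *ᵥ a) + b ⬝ᵥ (M *ᵥ b) := by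
    simp [dotProduct, mulVec, Finset.sum_add_distrib, ha, hb]
  have him : (star x ⬝ᵥ (M.map Complex.ofReal *ᵥ x)).im = 0 :=
    hherm.im_star_dotProduct_mulVec_self x
  have hnonneg (y : ι → ℝ) : 0 ≤ y ⬝ᵥ (M *ᵥ y) := by
    simpa using hM.posSemidef.dotProduct_mulVec_nonneg y
  have hpos {y : ι → ℝ} (hy : y ≠ 0) : 0 < y ⬝ᵥ (M *ᵥ y) := by
    simpa using hM.dotProduct_mulVec_pos hy
  rw [Complex.pos_iff, hre, him]
  refine ⟨?_, rfl⟩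
  by_cases h : a = 0
  · have hb0 : b ≠ 0 := fun h' => hx <| funext fun i =>
      Complex.ext (congrFun h i) (congrFun h' i)
    linarith [hnonneg a, hpos hb0]
  · linarith [hpos h, hnonneg b]

open scoped ComplexOrder in
/-- **Lyapunov's criterion**: if `P ≻ 0` and `-(P M + Mᴴ P) ≻ 0`, then every eigenvalue of `M` has
negative real part. -/
theorem Matrix.re_neg_of_mem_spectrum_of_lyapunov {ι : Type*} [Fintype ι] [DecidableEq ι]
    {M P N : Matrix ι ι ℂ} (hP : P.PosDef) (hN : N.PosDef) (h : P * M + Mᴴ * P = -N)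
    {z : ℂ} (hz : z ∈ spectrum ℂ M) : z.re < 0 := by
  rw [← spectrum_toLin', ← Module.End.hasEigenvalue_iff_mem_spectrum] at hz
  obtain ⟨v, hv⟩ := hz.exists_hasEigenvector
  have hMv : M *ᵥ v = z • v := by simpa using hv.apply_eq_smul
  have hPv := hP.dotProduct_mulVec_pos hv.2
  have hNv := hN.dotProduct_mulVec_pos hv.2
  have key : (z + star z) * (star v ⬝ᵥ (P *ᵥ v)) = -(star v ⬝ᵥ (N *ᵥ v)) := by
    rw [← dotProduct_neg, ← neg_mulVec, ← h, add_mulVec, dotProduct_add, ← mulVec_mulVec,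
      ← mulVec_mulVec, hMv, mulVec_smul, dotProduct_smul, dotProduct_mulVec (star v) Mᴴ,
      ← star_mulVec, hMv, star_smul, smul_dotProduct, smul_eq_mul, smul_eq_mul, add_mul]
  rw [Complex.pos_iff] at hPv hNv
  have hre := congrArg Complex.re key
  simp only [Complex.mul_re, Complex.add_re, Complex.star_def, Complex.conj_re, Complex.neg_re,
    ← hPv.2, mul_zero, sub_zero] at hre
  by_contra! hz0
  nlinarith [mul_nonneg hz0 hPv.1.le]

/-- If `Q₁ ≻ 0`, `R₁ ≻ 0` and `P₁ ≻ 0` is a symmetric positive definite solution of the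
algebraic Riccati equation `P₁ A + Aᵀ P₁ + Q₁ - P₁ B R₁ Bᵀ P₁ = 0`, then for every
`c ≥ 1/2` all eigenvalues of `A - c B R₁ Bᵀ P₁` (over `ℂ`) have negative real part. -/
theorem riccati_gain_half_stabilizes {n m : ℕ}
    (A : Matrix (Fin n) (Fin n) ℝ) (B : Matrix (Fin n) (Fin m) ℝ)
    (Q₁ : Matrix (Fin n) (Fin n) ℝ) (hQ₁ : Q₁.PosDef)
    (R₁ : Matrix (Fin m) (Fin m) ℝ) (hR₁ : R₁.PosDef)
    (P₁ : Matrix (Fin n) (Fin n) ℝ) (hP₁ : P₁.PosDef)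
    (hARE : P₁ * A + Aᵀ * P₁ + Q₁ - P₁ * B * R₁ * Bᵀ * P₁ = 0) :
    ∀ c : ℝ, (1 : ℝ) / 2 ≤ c →
      ∀ z ∈ spectrum ℂ ((A - c • (B * R₁ * Bᵀ * P₁)).map (Complex.ofReal)), z.re < 0 := by
  intro c hc z hz
  have hPt : P₁ᵀ = P₁ := by simpa using hP₁.1.eq
  have hRt : R₁ᵀ = R₁ := by simpa using hR₁.1.eq
  have hS : (P₁ * B * R₁ * Bᵀ * P₁).PosSemidef := by
    simpa [hPt, Matrix.mul_assoc] using hR₁.posSemidef.mul_mul_conjTranspose_same (P₁ * B)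
  have hN : (Q₁ + (2 * c - 1) • (P₁ * B * R₁ * Bᵀ * P₁)).PosDef :=
    hQ₁.add_posSemidef (hS.smul (by linarith))
  have hlyap : P₁ * (A - c • (B * R₁ * Bᵀ * P₁)) + (A - c • (B * R₁ * Bᵀ * P₁))ᵀ * P₁ =
      -(Q₁ + (2 * c - 1) • (P₁ * B * R₁ * Bᵀ * P₁)) := by
    simp only [transpose_sub, transpose_smul, transpose_mul, transpose_transpose, hPt, hRt,
      Matrix.mul_sub, Matrix.sub_mul, Matrix.mul_smul, Matrix.smul_mul, Matrix.mul_assoc] at hARE ⊢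
    linear_combination (norm := module) hARE
  refine re_neg_of_mem_spectrum_of_lyapunov hP₁.map_ofReal hN.map_ofReal ?_ hz
  have hadj (X : Matrix (Fin n) (Fin n) ℝ) :
      (X.map Complex.ofReal)ᴴ = Complex.ofRealHom.mapMatrix Xᵀ := by
    ext i j
    simp
  rw [hadj]
  have hmap := congrArg Complex.ofRealHom.mapMatrix hlyap
  rwa [map_add, map_mul, map_mul, map_neg] at hmap
end

section
/- Let A ∈ ℝ^{n×n}, B ∈ ℝ^{n×m}, R₁ ∈ ℝ^{m×m}. Let Λ ∈ ℝ^{q×q} be diagonal (1 ≤ q < n) and V ∈ ℝ^{n×q} satisfy Vᵀ A = Λ Vᵀ (the columns of V are left eigenvectors of A for the eigenvalues on the diagonal of Λ). Let Q̃₁ ∈ ℝ^{q×q} be symmetric, set R̃₁ = Vᵀ B R₁ Bᵀ V, and let P̃₁ ∈ ℝ^{q×q} be a symmetric solution of the reduced-order Riccati equation P̃₁ Λ + Λ P̃₁ − P̃₁ R̃₁ P̃₁ + Q̃₁ = 0. Then P₁ = V P̃₁ Vᵀ satisfies the full-order Riccati equation P₁ A + Aᵀ P₁ + Q₁ − P₁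 B R₁ Bᵀ P₁ = 0 with Q₁ = V Q̃₁ Vᵀ. -/
open Matrix

/-- If the columns of `V` are left eigenvectors of `A` (`Vᵀ A = Λ Vᵀ` with `Λ` diagonal)
and `P̃₁` is a symmetric solution of the reduced-order Riccati equation
`P̃₁ Λ + Λ P̃₁ - P̃₁ R̃₁ P̃₁ + Q̃₁ = 0` with `R̃₁ = Vᵀ B R₁ Bᵀ V`, then `P₁ = V P̃₁ Vᵀ`
solves the full-order Riccati equation with `Q₁ = V Q̃₁ Vᵀ`. -/
theorem reduced_riccati_lifts {n m q : ℕ} (hq : 1 ≤ q) (hqn : q < n)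
    (A : Matrix (Fin n) (Fin n) ℝ) (B : Matrix (Fin n) (Fin m) ℝ)
    (R₁ : Matrix (Fin m) (Fin m) ℝ)
    (d : Fin q → ℝ)
    (Λ : Matrix (Fin q) (Fin q) ℝ) (hΛ : Λ = Matrix.diagonal d)
    (V : Matrix (Fin n) (Fin q) ℝ) (hV : Vᵀ * A = Λ * Vᵀ)
    (Qt₁ : Matrix (Fin q) (Fin q) ℝ) (hQt₁ : Qt₁ᵀ = Qt₁)
    (Rt₁ : Matrix (Fin q) (Fin q) ℝ) (hRt₁ : Rt₁ = Vᵀ * B * R₁ * Bᵀ * V)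
    (Pt₁ : Matrix (Fin q) (Fin q) ℝ) (hPt₁ : Pt₁ᵀ = Pt₁)
    (hred : Pt₁ * Λ + Λ * Pt₁ - Pt₁ * Rt₁ * Pt₁ + Qt₁ = 0) :
    (V * Pt₁ * Vᵀ) * A + Aᵀ * (V * Pt₁ * Vᵀ) + V * Qt₁ * Vᵀ
      - (V * Pt₁ * Vᵀ) * B * R₁ * Bᵀ * (V * Pt₁ * Vᵀ) = 0 := by
  have hVT : Aᵀ * V = V * Λ := by
    simpa [hΛ, Matrix.transpose_mul] using congrArg Matrix.transpose hV
  have hPA : V * Pt₁ * Vᵀ * A = V * (Pt₁ * Λ) * Vᵀ := by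
    rw [Matrix.mul_assoc, hV]
    simp only [Matrix.mul_assoc]
  have hAP : Aᵀ * (V * Pt₁ * Vᵀ) = V * (Λ * Pt₁) * Vᵀ := by
    rw [← Matrix.mul_assoc, ← Matrix.mul_assoc, hVT]
    simp only [Matrix.mul_assoc]
  have hPRP : V * Pt₁ * Vᵀ * B * R₁ * Bᵀ * (V * Pt₁ * Vᵀ) = V * (Pt₁ * Rt₁ * Pt₁) * Vᵀ := by
    simp only [hRt₁, Matrix.mul_assoc]
  rw [hPA, hAP, hPRP, ← Matrix.add_mul, ← Matrix.mul_add, ← Matrix.add_mul, ← Matrix.mul_add,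
    ← Matrix.sub_mul, ← Matrix.mul_sub, add_sub_right_comm, hred, Matrix.mul_zero,
    Matrix.zero_mul]
end

section
/- Let A ∈ ℝ^{n×n}, B ∈ ℝ^{n×m}, R₁ ∈ ℝ^{m×m}. Let Λ ∈ ℝ^{q×q} be diagonal and V ∈ ℝ^{n×q} satisfy Vᵀ A = Λ Vᵀ; set H = Bᵀ V, P̃₁ ∈ ℝ^{q×q}, P₁ = V P̃₁ Vᵀ. Let L ∈ ℝ^{N×N}, μ ∈ ℝ, and 𝔸 = I_N ⊗ A − μ L ⊗ (B R₁ Bᵀ P₁). Suppose ρ ∈ ℂ^N satisfies ρ* L = γ ρ* (ρ* a left eigenvector of L with eigenvalue γ) and ξ ∈ ℂ^q satisfies ξ* Ξ_γ = α ξ*, where Ξ_γ = Λ − μ γ Hᵀ R₁ H P̃₁. Then (ρ* ⊗ (ξ* Vᵀ)) 𝔸 = α (ρ* ⊗ (ξ* Vᵀ)); in particular, if ρ ≠ 0, ξ ≠ 0, and V has linearly independent columns, then α is an eigenvalue of 𝔸. -/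
open Matrix Kronecker

namespace Matrix

/-- A product vector multiplied by a Kronecker product is the product of the two
vector-matrix products. -/
theorem prod_vecMul_kronecker {R l m n p : Type*} [CommSemiring R] [Fintype l] [Fintype n]
    (x : l → R) (y : n → R) (M : Matrix l m R) (K : Matrix n p R) :
    (fun i : l × n => x i.1 * y i.2) ᵥ* (M ⊗ₖ K) =
      fun j : m × p => (x ᵥ* M) j.1 * (y ᵥ* K) j.2 := by
  ext j
  simp only [vecMul, dotProduct, kroneckerMap_apply, Fintype.sum_prod_type, Finset.sum_mul_sum]
  exact Finset.sum_congr rfl fun _ _ => Finset.sum_congr rfl fun _ _ => mul_mul_mul_comm _ _ _ _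

/-- A nonzero left eigenvector witnesses that its eigenvalue lies in the spectrum. -/
theorem mem_spectrum_of_vecMul_eq_smul {K n : Type*} [Field K] [Fintype n] [DecidableEq n]
    {M : Matrix n n K} {w : n → K} {a : K} (hw : w ≠ 0) (h : w ᵥ* M = a • w) :
    a ∈ spectrum K M := by
  rw [spectrum.mem_iff]
  intro hu
  refine hw (vecMul_injective_of_isUnit hu ?_)
  simp [vecMul_sub, h, Algebra.algebraMap_eq_smul_one, vecMul_smul]

/-- Real linearly independent rows stay linearly independent over the complex numbers. -/
theorem eq_zero_of_vecMul_map_ofReal_eq_zero {m n : Type*} [Fintype m] {M : Matrix m n ℝ}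
    (hM : LinearIndependent ℝ M.row) {x : m → ℂ} (hx : x ᵥ* M.map Complex.ofReal = 0) : x = 0 := by
  rw [Fintype.linearIndependent_iff] at hM
  have hre := hM (fun i => (x i).re) (by
    ext j
    simpa [vecMul, dotProduct] using congrArg Complex.re (congrFun hx j))
  have him := hM (fun i => (x i).im) (by
    ext j
    simpa [vecMul, dotProduct] using congrArg Complex.im (congrFun hx j))
  ext i
  exact Complex.ext (hre i) (him i)

end Matrix

/-- If `ρ*` is a left eigenvector of `L` for the eigenvalue `γ` and `ξ*` is a left
eigenvector of `Ξ_γ = Λ - μ γ Hᵀ R₁ H P̃₁` for the eigenvalue `α`, then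
`ρ* ⊗ (ξ* Vᵀ)` is a left eigenvector of `𝔸 = I_N ⊗ A - μ L ⊗ (B R₁ Bᵀ P₁)` for `α`;
in particular `α ∈ σ(𝔸)` when `ρ ≠ 0`, `ξ ≠ 0` and `V` has independent columns. -/
theorem shifted_eigenvalues_of_closed_loop {n m q N : ℕ}
    (A : Matrix (Fin n) (Fin n) ℝ) (B : Matrix (Fin n) (Fin m) ℝ)
    (R₁ : Matrix (Fin m) (Fin m) ℝ)
    (d : Fin q → ℝ)
    (Λ : Matrix (Fin q) (Fin q) ℝ) (hΛ : Λ = Matrix.diagonal d)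
    (V : Matrix (Fin n) (Fin q) ℝ) (hV : Vᵀ * A = Λ * Vᵀ)
    (H : Matrix (Fin m) (Fin q) ℝ) (hH : H = Bᵀ * V)
    (Pt₁ : Matrix (Fin q) (Fin q) ℝ)
    (P₁ : Matrix (Fin n) (Fin n) ℝ) (hP₁ : P₁ = V * Pt₁ * Vᵀ)
    (L : Matrix (Fin N) (Fin N) ℝ) (μ : ℝ)
    (𝔸 : Matrix (Fin N × Fin n) (Fin N × Fin n) ℝ)
    (h𝔸 : 𝔸 = (1 : Matrix (Fin N) (Fin N) ℝ) ⊗ₖ A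
        - μ • (L ⊗ₖ (B * R₁ * Bᵀ * P₁)))
    (ρ : Fin N → ℂ) (γ : ℂ)
    (hρ : (star ρ) ᵥ* (L.map (Complex.ofReal)) = γ • star ρ)
    (ξ : Fin q → ℂ) (α : ℂ)
    (hξ : (star ξ) ᵥ* (Λ.map (Complex.ofReal)
        - (↑μ * γ) • ((Hᵀ * R₁ * H * Pt₁).map (Complex.ofReal))) = α • star ξ) :
    ((fun p : Fin N × Fin n =>
        star ρ p.1 * ((star ξ) ᵥ* (Vᵀ.map (Complex.ofReal))) p.2)
          ᵥ* (𝔸.map (Complex.ofReal))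
      = α • fun p : Fin N × Fin n =>
          star ρ p.1 * ((star ξ) ᵥ* (Vᵀ.map (Complex.ofReal))) p.2) ∧
    (ρ ≠ 0 → ξ ≠ 0 → LinearIndependent ℝ Vᵀ →
      α ∈ spectrum ℂ (𝔸.map (Complex.ofReal))) := by
  have hmul {a b c : ℕ} (X : Matrix (Fin a) (Fin b) ℝ) (Y : Matrix (Fin b) (Fin c) ℝ) :
      (X * Y).map Complex.ofReal = X.map Complex.ofReal * Y.map Complex.ofReal :=
    Matrix.map_mul (f := Complex.ofRealHom)
  have hmap : 𝔸.map Complex.ofReal = (1 : Matrix (Fin N) (Fin N) ℂ) ⊗ₖ A.map Complex.ofReal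
      - (μ : ℂ) • (L.map Complex.ofReal ⊗ₖ (B * R₁ * Bᵀ * P₁).map Complex.ofReal) := by
    ext i j
    simp [h𝔸, kroneckerMap_apply, Matrix.one_apply, apply_ite Complex.ofReal]
  have hB : Vᵀ * (B * R₁ * Bᵀ * P₁) = Hᵀ * R₁ * H * Pt₁ * Vᵀ := by
    simp [hP₁, hH, Matrix.mul_assoc]
  have hξV := congrArg (· ᵥ* Vᵀ.map Complex.ofReal) hξ
  simp only [vecMul_sub, vecMul_smul, sub_vecMul, smul_vecMul, vecMul_vecMul, ← hmul, ← hV,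
    ← hB] at hξV
  have heig : (fun p : Fin N × Fin n =>
        star ρ p.1 * ((star ξ) ᵥ* (Vᵀ.map (Complex.ofReal))) p.2)
          ᵥ* (𝔸.map (Complex.ofReal))
      = α • fun p : Fin N × Fin n =>
          star ρ p.1 * ((star ξ) ᵥ* (Vᵀ.map (Complex.ofReal))) p.2 := by
    rw [hmap, vecMul_sub, vecMul_smul, prod_vecMul_kronecker, prod_vecMul_kronecker, hρ,
      vecMul_one, vecMul_vecMul, vecMul_vecMul, ← hmul, ← hmul]
    ext p
    have hp := congrFun hξV p.2
    simp only [Pi.sub_apply, Pi.smul_apply, smul_eq_mul] at hp ⊢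
    linear_combination star ρ p.1 * hp
  refine ⟨heig, fun hρ₀ hξ₀ hind => mem_spectrum_of_vecMul_eq_smul (fun h => ?_) heig⟩
  obtain ⟨i, hi⟩ := Function.ne_iff.mp (star_ne_zero.mpr hρ₀)
  refine star_ne_zero.mpr hξ₀ (eq_zero_of_vecMul_map_ofReal_eq_zero hind ?_)
  ext j
  exact (mul_eq_zero.mp (congrFun h (i, j))).resolve_left hi
end

section
/- Let A ∈ ℝ^{n×n}, B ∈ ℝ^{n×m}, R₁ ∈ ℝ^{m×m}. Suppose λ₁, …, λ_q are real eigenvalues of A, each of algebraic multiplicity one, with corresponding real left eigenvectors ν₁, …, ν_q (νᵢᵀ A = λᵢ νᵢᵀ, νᵢ ≠ 0); set V = [ν₁ ⋯ ν_q] ∈ ℝ^{n×q}, Λ = diag(λ₁, …, λ_q), H = Bᵀ V. Let P̃₁ ∈ ℝ^{q×q}, P₁ = V P̃₁ Vᵀ, let L ∈ ℝ^{N×N} be symmetric, μ > 0, and 𝔸 = I_N ⊗ A − μ L ⊗ (B R₁ Bᵀ P₁). Then the spectrum of 𝔸 over ℂ satisfies σ(𝔸) = (⋃_{γ ∈ σ(L)}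 σ(Ξ_γ)) ∪ (σ(A) \ {λ₁, …, λ_q}), where Ξ_γ = Λ − μ γ Hᵀ R₁ H P̃₁. -/
open Matrix Kronecker Polynomial

namespace Matrix

variable {m n : Type*} [Fintype m] [DecidableEq m] [Fintype n] [DecidableEq n]

/-- A matrix determinant lemma for `M + K * W` when `W` intertwines `M` with a smaller matrix
`S`. -/
theorem det_add_mul_mul_det_of_intertwine {R : Type*} [CommRing R] {M : Matrix n n R}
    {S : Matrix m m R} {W : Matrix m n R} (h : W * M = S * W) (K : Matrix n m R) :
    (M + K * W).det * S.det = M.det * (S + W * K).det := by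
  have hblock : fromBlocks 1 0 0 S * fromBlocks M (-K) W 1
      = fromBlocks 1 0 W 1 * fromBlocks M (-K) 0 (S + W * K) := by
    simp [fromBlocks_multiply, h]
  have hdet := congrArg det hblock
  rw [det_mul, det_mul, det_fromBlocks_one₂₂, det_fromBlocks_zero₂₁, det_fromBlocks_zero₂₁,
    det_fromBlocks_zero₁₂] at hdet
  simpa [mul_comm] using hdet

theorem charpoly_sub_mul_mul_charpoly_of_intertwine {R : Type*} [CommRing R] {A : Matrix n n R}
    {S : Matrix m m R} {W : Matrix m n R} (h : W * A = S * W) (K : Matrix n m R) :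
    (A - K * W).charpoly * S.charpoly = A.charpoly * (S - W * K).charpoly := by
  have hchar : W.map C * charmatrix A = charmatrix S * W.map C := by
    have hC : W.map C * A.map C = S.map C * W.map (C : R →+* R[X]) := by
      rw [← Matrix.map_mul, ← Matrix.map_mul, h]
    simp only [charmatrix, RingHom.mapMatrix_apply, Matrix.mul_sub, Matrix.sub_mul, hC]
    congr 1
    ext i j : 2
    rw [scalar_apply, scalar_apply, mul_diagonal, diagonal_mul, mul_comm]
  have hdet := det_add_mul_mul_det_of_intertwine hchar (K.map C)
  have hA : charmatrix (A - K * W) = charmatrix A + K.map C * W.map C := by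
    simp only [charmatrix, map_sub, RingHom.mapMatrix_apply, ← Matrix.map_mul]
    abel
  have hS : charmatrix (S - W * K) = charmatrix S + W.map C * K.map C := by
    simp only [charmatrix, map_sub, RingHom.mapMatrix_apply, ← Matrix.map_mul]
    abel
  rwa [← hA, ← hS] at hdet

/-- Feedback through the left eigenvectors (the rows of `W`) of simple eigenvalues `d i` moves
only these eigenvalues. -/
theorem spectrum_sub_mul_of_simple {F : Type*} [Field F] {A : Matrix n n F} {d : m → F}
    {W : Matrix m n F} (h : W * A = diagonal d * W) (hd : Function.Injective d)
    (hmult : ∀ i, A.charpoly.rootMultiplicity (d i) = 1) (K : Matrix n m F) :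
    spectrum F (A - K * W)
      = spectrum F (diagonal d - W * K) ∪ (spectrum F A \ Set.range d) := by
  have hA0 : A.charpoly ≠ 0 := A.charpoly_monic.ne_zero
  have hroot : ∀ i, A.charpoly.IsRoot (d i) := fun i =>
    (rootMultiplicity_pos hA0).1 (by simp [hmult i])
  obtain ⟨g, hg⟩ : (diagonal d).charpoly ∣ A.charpoly := by
    rw [charpoly_diagonal]
    exact Fintype.prod_dvd_of_coprime (pairwise_coprime_X_sub_C hd)
      fun i => dvd_iff_isRoot.2 (hroot i)
  have hg0 : ∀ i, ¬ g.IsRoot (d i) := by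
    intro i hi
    have hdvd : (X - C (d i)) ^ 2 ∣ A.charpoly := by
      rw [hg, sq]
      refine mul_dvd_mul ?_ (dvd_iff_isRoot.2 hi)
      rw [charpoly_diagonal]
      exact Finset.dvd_prod_of_mem (fun j => X - C (d j)) (Finset.mem_univ i)
    have := (le_rootMultiplicity_iff hA0).2 hdvd
    rw [hmult i] at this
    omega
  have hcancel : (A - K * W).charpoly = (diagonal d - W * K).charpoly * g := by
    have hprod := charpoly_sub_mul_mul_charpoly_of_intertwine h K
    apply mul_right_cancel₀ (diagonal d).charpoly_monic.ne_zero
    rw [hprod, hg]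
    ring
  ext s
  have hmem : s ∈ spectrum F A ↔ s ∈ Set.range d ∨ g.IsRoot s := by
    rw [mem_spectrum_iff_isRoot_charpoly, hg, root_mul, ← mem_spectrum_iff_isRoot_charpoly,
      spectrum_diagonal]
  rw [Set.mem_union, Set.mem_sdiff, hmem, mem_spectrum_iff_isRoot_charpoly,
    mem_spectrum_iff_isRoot_charpoly, hcancel, root_mul]
  have : g.IsRoot s → s ∉ Set.range d := by
    rintro hs ⟨i, rfl⟩
    exact hg0 i hs
  tauto

theorem spectrum_one_kronecker_sub_diagonal_kronecker {F : Type*} [Field F] (d : m → F)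
    (A M : Matrix n n F) :
    spectrum F ((1 : Matrix m m F) ⊗ₖ A - diagonal d ⊗ₖ M)
      = ⋃ i, spectrum F (A - d i • M) := by
  ext s
  simp only [Set.mem_iUnion, mem_spectrum_iff_isRoot_charpoly, IsRoot.def, eval_charpoly]
  have hblock : scalar (m × n) s - ((1 : Matrix m m F) ⊗ₖ A - diagonal d ⊗ₖ M)
      = reindex (Equiv.prodComm _ _) (Equiv.prodComm _ _)
          (blockDiagonal fun i => scalar n s - (A - d i • M)) := by
    ext ⟨i, j⟩ ⟨k, l⟩
    by_cases hik : i = k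
    · subst hik
      by_cases hjl : j = l <;>
        simp [blockDiagonal_apply, kroneckerMap_apply, hjl]
    · simp [blockDiagonal_apply, kroneckerMap_apply, hik]
  rw [hblock, det_reindex_self, det_blockDiagonal, Finset.prod_eq_zero_iff]
  simp

theorem spectrum_one_kronecker_sub_kronecker {F : Type*} [Field F] (U : (Matrix m m F)ˣ)
    (d : m → F) (A M : Matrix n n F) :
    spectrum F ((1 : Matrix m m F) ⊗ₖ A
        - ((U : Matrix m m F) * diagonal d * (↑U⁻¹ : Matrix m m F)) ⊗ₖ M)
      = ⋃ i, spectrum F (A - d i • M) := by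
  let T : (Matrix (m × n) (m × n) F)ˣ :=
    ⟨(U : Matrix m m F) ⊗ₖ 1, (↑U⁻¹ : Matrix m m F) ⊗ₖ 1,
      by simp [← mul_kronecker_mul], by simp [← mul_kronecker_mul]⟩
  have hconj : (1 : Matrix m m F) ⊗ₖ A
        - ((U : Matrix m m F) * diagonal d * (↑U⁻¹ : Matrix m m F)) ⊗ₖ M
      = (T : Matrix (m × n) (m × n) F) * ((1 : Matrix m m F) ⊗ₖ A - diagonal d ⊗ₖ M)
        * (↑T⁻¹ : Matrix (m × n) (m × n) F) := by
    change _ = (U : Matrix m m F) ⊗ₖ (1 : Matrix n n F)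
      * ((1 : Matrix m m F) ⊗ₖ A - diagonal d ⊗ₖ M)
      * ((↑U⁻¹ : Matrix m m F) ⊗ₖ (1 : Matrix n n F))
    simp [mul_sub, sub_mul, ← mul_kronecker_mul]
  rw [hconj, spectrum.units_conjugate, spectrum_one_kronecker_sub_diagonal_kronecker]

theorem IsHermitian.spectrum_one_kronecker_sub_kronecker {𝕜 : Type*} [RCLike 𝕜]
    {L : Matrix m m 𝕜} (hL : L.IsHermitian) (A M : Matrix n n 𝕜) :
    spectrum 𝕜 ((1 : Matrix m m 𝕜) ⊗ₖ A - L ⊗ₖ M)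
      = ⋃ γ ∈ spectrum 𝕜 L, spectrum 𝕜 (A - γ • M) := by
  have hconj : L = (Unitary.toUnits hL.eigenvectorUnitary : Matrix m m 𝕜)
      * diagonal (RCLike.ofReal ∘ hL.eigenvalues)
      * (↑(Unitary.toUnits hL.eigenvectorUnitary)⁻¹ : Matrix m m 𝕜) := by
    conv_lhs => rw [hL.spectral_theorem, Unitary.conjStarAlgAut_apply]
    rfl
  have hspec : spectrum 𝕜 L = Set.range (RCLike.ofReal ∘ hL.eigenvalues : m → 𝕜) := by
    conv_lhs => rw [hconj]
    rw [spectrum.units_conjugate, spectrum_diagonal]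
  rw [hspec, Set.biUnion_range]
  conv_lhs => rw [hconj]
  exact Matrix.spectrum_one_kronecker_sub_kronecker _ _ _ _

end Matrix

/-- Spectrum characterization for the closed-loop MAS matrix with a reduced-order gain:
`σ(𝔸) = (⋃_{γ ∈ σ(L)} σ(Ξ_γ)) ∪ (σ(A) \ {λ₁, …, λ_q})`, where
`Ξ_γ = Λ - μ γ Hᵀ R₁ H P̃₁`, the `λ_i` are simple real eigenvalues of `A` with left
eigenvectors `ν_i`, `V = [ν₁ ⋯ ν_q]`, `Λ = diag(λ₁, …, λ_q)`, `H = Bᵀ V`, and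
`P₁ = V P̃₁ Vᵀ`. -/
theorem closed_loop_spectrum_characterization {n m q N : ℕ}
    (hq : 1 ≤ q) (hqn : q < n) (hN : 1 ≤ N)
    (A : Matrix (Fin n) (Fin n) ℝ) (B : Matrix (Fin n) (Fin m) ℝ)
    (R₁ : Matrix (Fin m) (Fin m) ℝ)
    (lam : Fin q → ℝ) (hlam : Function.Injective lam)
    (hmult : ∀ i, A.charpoly.rootMultiplicity (lam i) = 1)
    (ν : Fin q → Fin n → ℝ) (hν : ∀ i, ν i ≠ 0)
    (hleft : ∀ i, (ν i) ᵥ* A = lam i • ν i)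
    (V : Matrix (Fin n) (Fin q) ℝ) (hV : V = Matrix.of fun r c => ν c r)
    (Λ : Matrix (Fin q) (Fin q) ℝ) (hΛ : Λ = Matrix.diagonal lam)
    (H : Matrix (Fin m) (Fin q) ℝ) (hH : H = Bᵀ * V)
    (Pt₁ : Matrix (Fin q) (Fin q) ℝ)
    (P₁ : Matrix (Fin n) (Fin n) ℝ) (hP₁ : P₁ = V * Pt₁ * Vᵀ)
    (L : Matrix (Fin N) (Fin N) ℝ) (hLsymm : Lᵀ = L)
    (μ : ℝ) (hμ : 0 < μ)
    (𝔸 : Matrix (Fin N × Fin n) (Fin N × Fin n) ℝ)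
    (h𝔸 : 𝔸 = (1 : Matrix (Fin N) (Fin N) ℝ) ⊗ₖ A
        - μ • (L ⊗ₖ (B * R₁ * Bᵀ * P₁))) :
    spectrum ℂ (𝔸.map (Complex.ofReal))
      = (⋃ γ ∈ spectrum ℂ (L.map (Complex.ofReal)),
          spectrum ℂ (Λ.map (Complex.ofReal)
            - (↑μ * γ) • ((Hᵀ * R₁ * H * Pt₁).map (Complex.ofReal))))
        ∪ (spectrum ℂ (A.map (Complex.ofReal))
            \ Set.range fun i => (lam i : ℂ)) := by
  subst hV hΛ hH hP₁ h𝔸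
  set V : Matrix (Fin n) (Fin q) ℝ := Matrix.of fun r c => ν c r with hV
  have hVA : Vᵀ * A = diagonal lam * Vᵀ := by
    ext i j
    rw [diagonal_mul]
    exact congrFun (hleft i) j
  have hL : (L.map Complex.ofReal).IsHermitian := by
    ext i j
    simpa using congrFun (congrFun hLsymm i) j
  have hsplit : (((1 : Matrix (Fin N) (Fin N) ℝ) ⊗ₖ A
        - μ • (L ⊗ₖ (B * R₁ * Bᵀ * (V * Pt₁ * Vᵀ)))).map Complex.ofReal)
      = (1 : Matrix (Fin N) (Fin N) ℂ) ⊗ₖ A.map Complex.ofReal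
        - L.map Complex.ofReal ⊗ₖ
          ((μ : ℂ) • (B * R₁ * Bᵀ * (V * Pt₁ * Vᵀ)).map Complex.ofReal) := by
    ext ⟨i, j⟩ ⟨k, l⟩
    by_cases hik : i = k <;> simp [kroneckerMap_apply, hik, one_apply] <;> ring
  have hmap : ∀ {a b c : ℕ} (X : Matrix (Fin a) (Fin b) ℝ) (Y : Matrix (Fin b) (Fin c) ℝ),
      (X * Y).map Complex.ofReal = X.map Complex.ofReal * Y.map Complex.ofReal :=
    fun X Y => Matrix.map_mul (f := Complex.ofRealHom)
  have hdiag : (diagonal lam).map Complex.ofReal = diagonal fun i => (lam i : ℂ) := by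
    ext i j
    by_cases hij : i = j <;> simp [hij]
  have hmode : ∀ γ : ℂ,
      spectrum ℂ (A.map Complex.ofReal
          - γ • ((μ : ℂ) • (B * R₁ * Bᵀ * (V * Pt₁ * Vᵀ)).map Complex.ofReal))
        = spectrum ℂ ((diagonal lam).map Complex.ofReal
            - (↑μ * γ) • (((Bᵀ * V)ᵀ * R₁ * (Bᵀ * V) * Pt₁).map Complex.ofReal))
          ∪ (spectrum ℂ (A.map Complex.ofReal) \ Set.range fun i => (lam i : ℂ)) := by
    intro γ
    have hVA' : Vᵀ.map Complex.ofReal * A.map Complex.ofReal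
        = diagonal (fun i => (lam i : ℂ)) * Vᵀ.map Complex.ofReal := by
      rw [← hdiag, ← hmap, ← hmap, hVA]
    have hmult' : ∀ i, (A.map Complex.ofReal).charpoly.rootMultiplicity (lam i : ℂ) = 1 := by
      intro i
      rw [← hmult i, eq_rootMultiplicity_map (f := Complex.ofRealHom) Complex.ofReal_injective,
        ← charpoly_map]
      rfl
    have hspec := spectrum_sub_mul_of_simple hVA' (Complex.ofReal_injective.comp hlam) hmult'
      ((↑μ * γ) • (B * R₁ * Bᵀ * V * Pt₁).map Complex.ofReal)
    rw [Matrix.smul_mul, Matrix.mul_smul, ← hmap, ← hmap] at hspec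
    rw [hdiag, smul_smul, mul_comm γ]
    simpa only [transpose_mul, transpose_transpose, Matrix.mul_assoc] using hspec
  have : NeZero N := ⟨by omega⟩
  have hne : (spectrum ℂ (L.map Complex.ofReal)).Nonempty :=
    spectrum.nonempty_of_isAlgClosed_of_finiteDimensional ℂ _
  rw [hsplit, hL.spectrum_one_kronecker_sub_kronecker]
  simp_rw [hmode]
  simp_rw [Set.iUnion_union_distrib]
  rw [Set.biUnion_const hne]
end

section
/- Let A ∈ ℝ^{n×n}, B ∈ ℝ^{n×m}, R₁ ∈ ℝ^{m×m} symmetric, and let v ∈ ℝⁿ be a nonzero left eigenvector of A for the eigenvalue 0, i.e., vᵀ A = 0. Suppose r₁ = vᵀ B R₁ Bᵀ v > 0, and let q₁ > 0. Then P₁ = √(q₁/r₁) · v vᵀ satisfies the algebraic Riccati equation P₁ A + Aᵀ P₁ + Q₁ − P₁ B R₁ Bᵀ P₁ = 0 with Q₁ = q₁ v vᵀ, and the resulting gain is K = R₁ Bᵀ P₁ = √(q₁/r₁) · R₁ Bᵀ v vᵀ, a matrix of rank at most one. -/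
open Matrix

/-- If `v` is a nonzero left eigenvector of `A` for the eigenvalue `0` and
`r₁ = vᵀ B R₁ Bᵀ v > 0`, then `P₁ = √(q₁/r₁) v vᵀ` solves the algebraic Riccati
equation with `Q₁ = q₁ v vᵀ`, and the resulting gain
`K = R₁ Bᵀ P₁ = √(q₁/r₁) R₁ Bᵀ v vᵀ` has rank at most one. -/
theorem rank_one_riccati_solution {n m : ℕ}
    (A : Matrix (Fin n) (Fin n) ℝ) (B : Matrix (Fin n) (Fin m) ℝ)
    (R₁ : Matrix (Fin m) (Fin m) ℝ) (hR₁ : R₁ᵀ = R₁)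
    (v : Fin n → ℝ) (hv : v ≠ 0) (hvA : v ᵥ* A = 0)
    (r₁ : ℝ) (hr₁ : r₁ = v ⬝ᵥ ((B * R₁ * Bᵀ) *ᵥ v)) (hr₁pos : 0 < r₁)
    (q₁ : ℝ) (hq₁ : 0 < q₁)
    (P₁ : Matrix (Fin n) (Fin n) ℝ)
    (hP₁ : P₁ = Real.sqrt (q₁ / r₁) • Matrix.vecMulVec v v)
    (Q₁ : Matrix (Fin n) (Fin n) ℝ) (hQ₁ : Q₁ = q₁ • Matrix.vecMulVec v v) :
    P₁ * A + Aᵀ * P₁ + Q₁ - P₁ * B * R₁ * Bᵀ * P₁ = 0 ∧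
    R₁ * Bᵀ * P₁ = Real.sqrt (q₁ / r₁) • (R₁ * Bᵀ * Matrix.vecMulVec v v) ∧
    (R₁ * Bᵀ * P₁).rank ≤ 1 := by
  have hPA : vecMulVec v v * A = 0 := by
    rw [vecMulVec_mul, hvA, vecMulVec_zero]
  have hAP : Aᵀ * vecMulVec v v = 0 := by
    rw [mul_vecMulVec, mulVec_transpose, hvA, zero_vecMulVec]
  have hquad : vecMulVec v v * (B * R₁ * Bᵀ) * vecMulVec v v = r₁ • vecMulVec v v := by
    rw [Matrix.mul_assoc, mul_vecMulVec, vecMulVec_mul_vecMulVec, ← hr₁, vecMulVec_smul]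
  have hsqrt : √(q₁ / r₁) * (√(q₁ / r₁) * r₁) = q₁ := by
    rw [← mul_assoc, Real.mul_self_sqrt (by positivity), div_mul_cancel₀ _ hr₁pos.ne']
  subst hP₁ hQ₁
  refine ⟨?_, Matrix.mul_smul _ _ _, ?_⟩
  · have hPBP : √(q₁ / r₁) • vecMulVec v v * B * R₁ * Bᵀ * √(q₁ / r₁) • vecMulVec v v
        = q₁ • vecMulVec v v := by
      rw [show √(q₁ / r₁) • vecMulVec v v * B * R₁ * Bᵀ
          = √(q₁ / r₁) • (vecMulVec v v * (B * R₁ * Bᵀ)) by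
            simp only [Matrix.smul_mul, Matrix.mul_assoc],
        Matrix.smul_mul, Matrix.mul_smul, hquad, smul_smul, smul_smul, mul_assoc, hsqrt]
    rw [hPBP, Matrix.smul_mul, Matrix.mul_smul, hPA, hAP]
    simp
  · rw [← vecMulVec_smul, mul_vecMulVec]
    exact rank_vecMulVec_le _ _
end

section
/- Let A ∈ ℝ^{n×n}, B ∈ ℝ^{n×m}, R₁ ∈ ℝ^{m×m} symmetric, and let v ∈ ℝⁿ be a nonzero left eigenvector of A for the eigenvalue 0 (vᵀ A = 0), with 0 an eigenvalue of A of algebraic multiplicity one. Suppose r₁ = vᵀ B R₁ Bᵀ v > 0, q₁ > 0, and set K = √(q₁/r₁) · R₁ Bᵀ v vᵀ. Then for any real c > 0, the spectrum of A − c B K over ℂ is σ(A − c B K) = {−c √(q₁ r₁)} ∪ (σ(A) \ {0}). -/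
open Matrix Polynomial

/-- A rank-one perturbation `u vᵀ` along a left null vector `v` of `A` moves one zero root of the
characteristic polynomial to `u ⬝ᵥ v` and leaves the other roots in place. -/
theorem Matrix.X_mul_charpoly_add_vecMulVec {ι R : Type*} [Fintype ι] [DecidableEq ι] [CommRing R]
    (A : Matrix ι ι R) (u v : ι → R) (hvA : v ᵥ* A = 0) :
    X * (A + vecMulVec u v).charpoly = (X - C (u ⬝ᵥ v)) * A.charpoly := by
  rcases isEmpty_or_nonempty ι with hι | hι
  · simp [charpoly, dotProduct]
  have hvec : vecMulVec u v * A = 0 := by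
    rw [vecMulVec_mul, hvA, vecMulVec_zero]
  have hfac : (X : R[X]) • (A + vecMulVec u v).charmatrix
      = (vecMulVec u v).charmatrix * A.charmatrix := by
    have hvec' : (vecMulVec u v).map C * A.map (C : R →+* R[X]) = 0 := by
      rw [← Matrix.map_mul, hvec, Matrix.map_zero _ (map_zero _)]
    simp only [charmatrix, RingHom.mapMatrix_apply, Matrix.map_add _ (map_add (C : R →+* R[X])),
      ← smul_one_eq_diagonal, scalar_apply, sub_mul, mul_sub, smul_mul_assoc, mul_smul_comm,
      one_mul, mul_one, hvec', smul_sub, smul_add]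
    abel
  have hdet := congrArg det hfac
  rw [det_smul, det_mul] at hdet
  change X ^ _ * (A + vecMulVec u v).charpoly = (vecMulVec u v).charpoly * A.charpoly at hdet
  rw [charpoly_vecMulVec] at hdet
  obtain ⟨k, hk⟩ := Nat.exists_eq_succ_of_ne_zero (Fintype.card_ne_zero (α := ι))
  rw [hk, Nat.succ_sub_one, smul_eq_C_mul, pow_succ] at hdet
  apply (isRegular_X_pow k).left
  simp only
  linear_combination hdet

/-- If `v` is a nonzero left eigenvector of `A` for the simple eigenvalue `0`,
`r₁ = vᵀ B R₁ Bᵀ v > 0`, `q₁ > 0` and `K = √(q₁/r₁) R₁ Bᵀ v vᵀ`, then for every `c > 0`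
the spectrum of `A - c B K` over `ℂ` is `{-c √(q₁ r₁)} ∪ (σ(A) \ {0})`. -/
theorem spectrum_first_order_gain {n m : ℕ}
    (A : Matrix (Fin n) (Fin n) ℝ) (B : Matrix (Fin n) (Fin m) ℝ)
    (R₁ : Matrix (Fin m) (Fin m) ℝ) (hR₁ : R₁ᵀ = R₁)
    (v : Fin n → ℝ) (hv : v ≠ 0) (hvA : v ᵥ* A = 0)
    (hsimple : A.charpoly.rootMultiplicity 0 = 1)
    (r₁ : ℝ) (hr₁ : r₁ = v ⬝ᵥ ((B * R₁ * Bᵀ) *ᵥ v)) (hr₁pos : 0 < r₁)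
    (q₁ : ℝ) (hq₁ : 0 < q₁)
    (K : Matrix (Fin m) (Fin n) ℝ)
    (hK : K = Real.sqrt (q₁ / r₁) • (R₁ * Bᵀ * Matrix.vecMulVec v v)) :
    ∀ c : ℝ, 0 < c →
      spectrum ℂ ((A - c • (B * K)).map (Complex.ofReal))
        = {(-(c * Real.sqrt (q₁ * r₁)) : ℂ)}
          ∪ (spectrum ℂ (A.map (Complex.ofReal)) \ {0}) := by
  intro c _
  set w : Fin n → ℝ := (-(c * √(q₁ / r₁))) • ((B * R₁ * Bᵀ) *ᵥ v) with hw
  have hM : A - c • (B * K) = A + vecMulVec w v := by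
    rw [hK, hw, smul_vecMulVec, ← mul_vecMulVec, Matrix.mul_smul, smul_smul, neg_smul,
      ← sub_eq_add_neg]
    simp only [Matrix.mul_assoc]
  have hsqrt : √(q₁ / r₁) * r₁ = √(q₁ * r₁) := by
    rw [Real.sqrt_div hq₁.le, Real.sqrt_mul hq₁.le, div_mul_eq_mul_div, mul_div_assoc,
      Real.div_sqrt]
  have hdot : w ⬝ᵥ v = -(c * √(q₁ * r₁)) := by
    rw [hw, smul_dotProduct, dotProduct_comm, ← hr₁, smul_eq_mul, ← hsqrt]
    ring
  obtain ⟨g, hAg, hg⟩ := exists_eq_pow_rootMultiplicity_mul_and_not_dvd A.charpoly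
    A.charpoly_monic.ne_zero 0
  rw [hsimple, pow_one, C_0, sub_zero] at hAg
  rw [C_0, sub_zero, X_dvd_iff] at hg
  have hMg : (A - c • (B * K)).charpoly = (X - C (-(c * √(q₁ * r₁)))) * g := by
    apply mul_left_cancel₀ (X_ne_zero (R := ℝ))
    rw [hM, X_mul_charpoly_add_vecMulVec A w v hvA, hdot, hAg]
    ring
  have hg₀ : (g.map Complex.ofRealHom).eval 0 ≠ 0 := by
    rw [← coeff_zero_eq_eval_zero, coeff_map]
    simpa using hg
  have hspec (N : Matrix (Fin n) (Fin n) ℝ) (z : ℂ) :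
      z ∈ spectrum ℂ (N.map Complex.ofReal) ↔ (N.charpoly.map Complex.ofRealHom).eval z = 0 := by
    rw [← charpoly_map]
    exact mem_spectrum_iff_isRoot_charpoly
  ext z
  simp only [Set.mem_union, Set.mem_singleton_iff, Set.mem_sdiff, hspec, hMg, hAg,
    Polynomial.map_mul, eval_mul, mul_eq_zero, Polynomial.map_sub, map_X, map_C, eval_sub, eval_X,
    eval_C, sub_eq_zero]
  have hcast : Complex.ofRealHom (-(c * √(q₁ * r₁))) = -((c : ℂ) * (√(q₁ * r₁) : ℝ)) := by simp
  rw [hcast]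
  have hz : (g.map Complex.ofRealHom).eval z = 0 → z ≠ 0 := by
    rintro h rfl
    exact hg₀ h
  tauto
end
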